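/- arXiv:2404.07639 — 5 statements merged into one kernel-verified Lean document; each statement's English description precedes it below -/
import Mathlib

section
/- Let R be a commutative Noetherian integral domain, n ≥ 2 an integer, and 1 ≤ i ≤ n-1. Then Ext¹_{R[n]}(R, R[i]) is isomorphic to R, and for any short exact sequence 0 → R[i] → P → R → 0 of R[n]-modules with class σ ∈ Ext¹_{R[n]}(R, R[i]) ≅ R, one has P ≅ R[i+1] as R[n]-modules if and only if σ is a unit of R. -/
open Polynomial

noncomputable section

/-- The primitive multiple ring `R[n] = R[t]/(t^n)`. -/
abbrev Rn (R : Type*) [CommRing R] (n : ℕ) : Type _ :=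
  Polynomial R ⧸ Ideal.span {(X : Polynomial R) ^ n}

/-- The class `t` of the variable in `R[n]`. -/
def tn (R : Type*) [CommRing R] (n : ℕ) : Rn R n :=
  Ideal.Quotient.mk _ X

/-- `R[k] = R[n]/(t^k)` as an `R[n]`-module (for `k ≤ n` this is `R[t]/(t^k)`
with the `R[n]`-module structure coming from the natural surjection `R[n] → R[k]`). -/
abbrev Rmod (R : Type*) [CommRing R] (n k : ℕ) : Type _ :=
  Rn R n ⧸ (Ideal.span {tn R n ^ k})

/-- The constant term homomorphism `R[n] → R` (for `n > 0`). -/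
def ct (R : Type*) [CommRing R] (n : ℕ) (hn : 0 < n) : Rn R n →+* R :=
  Ideal.Quotient.lift _ (evalRingHom 0) (by
    intro a ha
    rw [Ideal.mem_span_singleton] at ha
    obtain ⟨c, rfl⟩ := ha
    simp [zero_pow hn.ne'])

section Modules

variable (R : Type*) [CommRing R] (n : ℕ) (M : Type*) [AddCommGroup M] [Module (Rn R n) M]

/-- The submodule `M_i = t^i M` of an `R[n]`-module `M`. -/
def tMi (i : ℕ) : Submodule (Rn R n) M :=
  LinearMap.range (LinearMap.lsmul (Rn R n) M (tn R n ^ i))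

/-- The submodule `M^{(i)} = {m ∈ M : t^i m = 0}` of an `R[n]`-module `M`. -/
def kt (i : ℕ) : Submodule (Rn R n) M :=
  LinearMap.ker (LinearMap.lsmul (Rn R n) M (tn R n ^ i))

/-- `G_i(M) = t^i M / t^{i+1} M`. -/
abbrev Gi (i : ℕ) :=
  (tMi R n M i) ⧸ (Submodule.comap (tMi R n M i).subtype (tMi R n M (i + 1)))

/-- `G^{(i+1)}(M) = M^{(i+1)}/M^{(i)}` (note the shift by one in the indexing:
`Gup R n M i` is `G^{(i+1)}(M)`). -/
abbrev Gup (i : ℕ) :=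
  (kt R n M (i + 1)) ⧸ (Submodule.comap (kt R n M (i + 1)).subtype (kt R n M i))

lemma tMi_succ_mem {i : ℕ} {x : M} (hx : x ∈ tMi R n M i) :
    tn R n • x ∈ tMi R n M (i + 1) := by
  obtain ⟨m, rfl⟩ := hx
  exact ⟨m, by simp [LinearMap.lsmul_apply, smul_smul, pow_succ']⟩

lemma kt_pred_mem {i : ℕ} {x : M} (hx : x ∈ kt R n M (i + 1)) :
    tn R n • x ∈ kt R n M i := by
  simp only [kt, LinearMap.mem_ker, LinearMap.lsmul_apply] at hx ⊢
  rw [smul_smul, ← pow_succ]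
  exact hx

/-- `μ_i : G_i(M) → G_{i+1}(M)`, induced by multiplication by `t`. -/
def muMap (i : ℕ) : Gi R n M i →ₗ[Rn R n] Gi R n M (i + 1) :=
  Submodule.mapQ _ _
    (LinearMap.restrict (LinearMap.lsmul (Rn R n) M (tn R n))
      (fun _ hx => tMi_succ_mem R n M hx))
    (fun x hx => by
      simp only [Submodule.mem_comap] at hx ⊢
      exact tMi_succ_mem R n M hx)

/-- `λ_{i+1} : G^{(i+2)}(M) → G^{(i+1)}(M)`, induced by multiplication by `t`
(with the shifted indexing, `lamMap R n M i : Gup (i+1) → Gup i`). -/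
def lamMap (i : ℕ) : Gup R n M (i + 1) →ₗ[Rn R n] Gup R n M i :=
  Submodule.mapQ _ _
    (LinearMap.restrict (LinearMap.lsmul (Rn R n) M (tn R n))
      (fun _ hx => kt_pred_mem R n M hx))
    (fun x hx => by
      simp only [Submodule.mem_comap] at hx ⊢
      exact kt_pred_mem R n M hx)

/-- The composition `μ_{k-1} ∘ ... ∘ μ_0 : G_0(M) → G_k(M)`. -/
def muComp : (k : ℕ) → (Gi R n M 0 →ₗ[Rn R n] Gi R n M k)
  | 0 => LinearMap.id
  | (k + 1) => (muMap R n M k).comp (muComp k)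

/-- The composition `λ_1 ∘ ... ∘ λ_k : G^{(k+1)}(M) → G^{(1)}(M)`. -/
def lamComp : (k : ℕ) → (Gup R n M k →ₗ[Rn R n] Gup R n M 0)
  | 0 => LinearMap.id
  | (k + 1) => (lamComp k).comp (lamMap R n M k)

end Modules

open CategoryTheory

universe u

universe v w

theorem AddMonoidHom.exists_addEquiv_of_ker_eq {G H B : Type*} [AddCommGroup G] [AddCommGroup H]
    [AddCommGroup B] (δ : G →+ H) (ev : G →+ B) (hδ : Function.Surjective δ)
    (hev : Function.Surjective ev) (h : δ.ker = ev.ker) :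
    ∃ e : H ≃+ B, ∀ g, e (δ g) = ev g := by
  refine ⟨(QuotientAddGroup.quotientKerEquivOfSurjective δ hδ).symm.trans
    ((QuotientAddGroup.quotientAddEquivOfEq h).trans
      (QuotientAddGroup.quotientKerEquivOfSurjective ev hev)), fun g => ?_⟩
  have : (QuotientAddGroup.quotientKerEquivOfSurjective δ hδ).symm (δ g) =
      (g : G ⧸ δ.ker) := by
    rw [AddEquiv.symm_apply_eq]; rfl
  simp only [AddEquiv.trans_apply, this]
  rfl

/-- Given a projective presentation `0 → K → Q → M → 0`, the group `Ext¹(M, N)` is the cokernel of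
`Hom(Q, N) → Hom(K, N)`, and the class of an extension of `M` by `N` is represented by any `K ⟶ N`
obtained by lifting `Q ⟶ M` to the extension. -/
theorem exists_ext_one_addEquiv_of_projective {C : Type*} [Category.{v} C] [Abelian C]
    [HasExt.{w} C] {K Q M : C} {ι : K ⟶ Q} {π : Q ⟶ M} {w₀ : ι ≫ π = 0}
    (hS₀ : (ShortComplex.mk ι π w₀).ShortExact) [Projective Q] {N : C} {B : Type*} [AddCommGroup B]
    (ev : (K ⟶ N) →+ B) (hev : Function.Surjective ev)
    (hker : ∀ φ, ev φ = 0 ↔ ∃ ψ : Q ⟶ N, ι ≫ ψ = φ) :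
    ∃ e : Abelian.Ext.{w} M N 1 ≃+ B,
      ∀ (P : C) (f : N ⟶ P) (g : P ⟶ M) (w : f ≫ g = 0)
        (hS : (ShortComplex.mk f g w).ShortExact) (h : Q ⟶ P) (φ : K ⟶ N),
        h ≫ g = π → φ ≫ f = ι ≫ h → e hS.extClass = ev φ := by
  let δ : (K ⟶ N) →+ Abelian.Ext.{w} M N 1 :=
    AddMonoidHom.mk' (fun φ => hS₀.extClass.comp (Abelian.Ext.mk₀ φ) (add_zero 1))
      (fun φ ψ => by rw [Abelian.Ext.mk₀_add, Abelian.Ext.comp_add])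
  have hδ : Function.Surjective δ := by
    intro x
    obtain ⟨x₁, hx₁⟩ := Abelian.Ext.contravariant_sequence_exact₃ hS₀ N x
      (Abelian.Ext.eq_zero_of_projective (P := Q) _) (add_zero 1)
    obtain ⟨φ, rfl⟩ := Abelian.Ext.addEquiv₀.symm.surjective x₁
    exact ⟨φ, hx₁⟩
  have hk : δ.ker = ev.ker := by
    ext φ
    rw [AddMonoidHom.mem_ker, AddMonoidHom.mem_ker, hker]
    constructor
    · intro h
      obtain ⟨x₂, hx₂⟩ := Abelian.Ext.contravariant_sequence_exact₁ hS₀ N _ (add_zero 1) h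
      obtain ⟨ψ, rfl⟩ := Abelian.Ext.addEquiv₀.symm.surjective x₂
      refine ⟨ψ, Abelian.Ext.addEquiv₀.symm.injective ?_⟩
      exact (Abelian.Ext.mk₀_comp_mk₀ _ _).symm.trans hx₂
    · rintro ⟨ψ, rfl⟩
      change hS₀.extClass.comp (Abelian.Ext.mk₀ (ι ≫ ψ)) (add_zero 1) = 0
      rw [← Abelian.Ext.mk₀_comp_mk₀]
      exact hS₀.extClass_comp_assoc _
  obtain ⟨e, he⟩ := AddMonoidHom.exists_addEquiv_of_ker_eq δ ev hδ hev hk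
  refine ⟨e, fun P f g w hS h φ hg hf => ?_⟩
  let F : ShortComplex.mk ι π w₀ ⟶ ShortComplex.mk f g w :=
    { τ₁ := φ, τ₂ := h, τ₃ := 𝟙 _, comm₁₂ := hf, comm₂₃ := by simpa using hg }
  have hnat : δ φ = hS.extClass :=
    (ShortComplex.ShortExact.extClass_naturality.{w} hS₀ hS F).trans (Abelian.Ext.mk₀_id_comp _)
  rw [← hnat, he]

section

variable {A : Type u} [CommRing A]

theorem exists_linearMap_span_singleton_apply_eq {t : A} {N : Type*} [AddCommGroup N] [Module A N]
    (y : N) (hy : ∀ s : A, s * t = 0 → s • y = 0) :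
    ∃ φ : Ideal.span {t} →ₗ[A] N, φ ⟨t, Ideal.mem_span_singleton_self t⟩ = y := by
  choose c hc using fun x : Ideal.span {t} => Ideal.mem_span_singleton'.1 x.2
  have key : ∀ a b : A, a * t = b * t → a • y = b • y := fun a b h => by
    rw [← sub_eq_zero, ← sub_smul]
    exact hy _ (by rw [sub_mul, h, sub_self])
  refine ⟨{ toFun := fun x => c x • y, map_add' := fun x x' => ?_, map_smul' := fun a x => ?_ }, ?_⟩
  · rw [← add_smul]
    exact key _ _ (by rw [add_mul, hc, hc, hc]; rfl)
  · rw [RingHom.id_apply, smul_smul]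
    exact key _ _ (by rw [mul_assoc, hc, hc]; rfl)
  · change c _ • y = y
    conv_rhs => rw [← one_smul A y]
    exact key _ _ (by rw [hc, one_mul])

theorem exists_ext_one_quotient_span_singleton_addEquiv [HasExt.{w} (ModuleCat.{u} A)]
    {I : Ideal A} {t : A}
    (hI : I = Ideal.span {t}) {N : Type u} [AddCommGroup N] [Module A N]
    (hN : ∀ s : A, s * t = 0 → ∀ x : N, s • x = 0) {B : Type*} [AddCommGroup B]
    (ε : N →+ B) (hε : Function.Surjective ε) (hker : ∀ x, ε x = 0 ↔ ∃ z, t • z = x) :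
    ∃ e : Abelian.Ext.{w} (ModuleCat.of A (A ⧸ I)) (ModuleCat.of A N) 1 ≃+ B,
      ∀ (P : ModuleCat.{u} A) (f : ModuleCat.of A N ⟶ P) (g : P ⟶ ModuleCat.of A (A ⧸ I))
        (w : f ≫ g = 0) (hS : (ShortComplex.mk f g w).ShortExact) (p : P) (y : N),
        g.hom p = (1 : A ⧸ I) → f.hom y = t • p → e hS.extClass = ε y := by
  subst hI
  let I : Ideal A := Ideal.span {t}
  let τ : I := ⟨t, Ideal.mem_span_singleton_self t⟩
  let ι : ModuleCat.of A I ⟶ ModuleCat.of A A := ModuleCat.ofHom I.subtype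
  let π : ModuleCat.of A A ⟶ ModuleCat.of A (A ⧸ I) := ModuleCat.ofHom I.mkQ
  have w₀ : ι ≫ π = 0 := ModuleCat.hom_ext (LinearMap.ext fun x =>
    (Submodule.Quotient.mk_eq_zero I).2 x.2)
  have hS₀ : (ShortComplex.mk ι π w₀).ShortExact :=
    { exact := (ShortComplex.moduleCat_exact_iff _).2 fun x hx =>
        ⟨⟨x, (Submodule.Quotient.mk_eq_zero I).1 hx⟩, rfl⟩
      mono_f := (ModuleCat.mono_iff_injective _).2 Subtype.val_injective
      epi_g := (ModuleCat.epi_iff_surjective _).2 I.mkQ_surjective }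
  let ev : (ModuleCat.of A I ⟶ ModuleCat.of A N) →+ B :=
    AddMonoidHom.mk' (fun φ => ε (φ.hom τ)) (fun φ ψ => by simp)
  obtain ⟨e, he⟩ := exists_ext_one_addEquiv_of_projective.{u, w} hS₀ ev
    (fun b => by
      obtain ⟨y, rfl⟩ := hε b
      obtain ⟨φ, hφ⟩ := exists_linearMap_span_singleton_apply_eq y (fun s hs => hN s hs y)
      exact ⟨ModuleCat.ofHom φ, congrArg ε hφ⟩)
    (fun φ => by
      refine (hker (φ.hom τ)).trans ⟨?_, ?_⟩
      · rintro ⟨z, hz⟩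
        refine ⟨ModuleCat.ofHom (LinearMap.toSpanSingleton A N z), ?_⟩
        ext ⟨x, hx⟩
        obtain ⟨a, rfl⟩ := Ideal.mem_span_singleton'.1 hx
        change (a * t) • z = φ.hom (a • τ)
        rw [map_smul, ← hz, mul_smul]
      · rintro ⟨ψ, rfl⟩
        refine ⟨ψ.hom (1 : A), ?_⟩
        rw [← map_smul, smul_eq_mul, mul_one]
        rfl)
  refine ⟨e, fun P f g w hS p y hp hy => ?_⟩
  obtain ⟨φ, hφ⟩ := exists_linearMap_span_singleton_apply_eq y (fun s hs => hN s hs y)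
  refine (he P f g w hS (ModuleCat.ofHom (LinearMap.toSpanSingleton A P p)) (ModuleCat.ofHom φ)
    ?_ ?_).trans (congrArg ε hφ)
  · ext
    change g.hom ((1 : A) • p) = _
    rw [one_smul]
    exact hp
  · ext ⟨x, hx⟩
    obtain ⟨a, rfl⟩ := Ideal.mem_span_singleton'.1 hx
    change f.hom (φ (a • τ)) = (a * t) • p
    rw [map_smul, map_smul, hφ, hy, mul_smul]

theorem nonempty_linearEquiv_quotient_span_pow_succ_iff {t : A} {i : ℕ} {P : Type*}
    [AddCommGroup P] [Module A P] {f : (A ⧸ Ideal.span {t ^ i}) →ₗ[A] P}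
    {g : P →ₗ[A] (A ⧸ Ideal.span {t ^ 1})} (hf : Function.Injective f)
    (hfg : Function.Exact f g) {p : P} {a : A} (hp : g p = 1)
    (ha : f (Ideal.Quotient.mk _ a) = t • p) :
    Nonempty (P ≃ₗ[A] (A ⧸ Ideal.span {t ^ (i + 1)})) ↔ IsCoprime a (t ^ i) := by
  have hmk : ∀ {k : ℕ} (c : A), c • (1 : A ⧸ Ideal.span {t ^ k}) = Ideal.Quotient.mk _ c := by
    intro k c
    rw [Algebra.smul_def, mul_one]; rfl
  have hmk0 : ∀ {k : ℕ} (c : A), c • (1 : A ⧸ Ideal.span {t ^ k}) = 0 ↔ t ^ k ∣ c := by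
    intro k c
    rw [hmk, Ideal.Quotient.eq_zero_iff_mem, Ideal.mem_span_singleton]
  constructor
  · rintro ⟨E⟩
    set q : P := E.symm 1 with hq
    have hgen : ∀ x : P, ∃ c : A, c • q = x := by
      intro x
      obtain ⟨c, hc⟩ := Ideal.Quotient.mk_surjective (E x)
      exact ⟨c, by rw [hq, ← map_smul, hmk, hc, E.symm_apply_apply]⟩
    have hq0 : ∀ c : A, t ^ (i + 1) ∣ c → c • q = 0 := by
      intro c hc
      rw [hq, ← map_smul, (hmk0 c).2 hc, map_zero]
    obtain ⟨c, hc⟩ := hgen p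
    obtain ⟨u, hu⟩ := Ideal.Quotient.mk_surjective (g q)
    have hcu : t ^ 1 ∣ c * u - 1 := by
      rw [← hmk0, sub_smul, mul_smul, hmk u, hu, ← map_smul, hc, hp, one_smul, sub_self]
    rw [pow_one] at hcu
    obtain ⟨r, hr⟩ := hcu
    have hct : IsCoprime c t := ⟨u, -r, by linear_combination hr⟩
    have hut : IsCoprime u t := ⟨c, -r, by linear_combination hr⟩
    obtain ⟨v, s, hvs⟩ := hct.pow_right (n := i + 1)
    have hvp : v • p = q := by
      rw [← hc, smul_smul, eq_sub_of_add_eq hvs, sub_smul, one_smul, hq0 _ (Dvd.intro_left _ rfl),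
        sub_zero]
    obtain ⟨d, hd⟩ := hgen (f 1)
    have hgd : t ∣ d * u := by
      have := hfg.apply_apply_eq_zero 1
      rw [← hd, map_smul, ← hu, ← hmk, smul_smul, hmk0, pow_one] at this
      exact this
    obtain ⟨d', rfl⟩ := hut.symm.dvd_of_dvd_mul_right hgd
    have h1 : f ((1 - d' * v * a) • 1) = 0 := by
      rw [sub_smul, one_smul, map_sub, mul_smul, hmk a, map_smul, ha, ← hd, ← hvp]
      module
    rw [map_eq_zero_iff f hf, hmk0] at h1
    obtain ⟨m, hm⟩ := h1
    exact ⟨d' * v, m, by linear_combination -hm⟩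
  · intro hco
    obtain ⟨b, m, hbm⟩ := id hco
    have h1 : f 1 = (b * t) • p := by
      rw [mul_smul, ← ha, ← hmk, ← map_smul, smul_smul, eq_sub_of_add_eq hbm, sub_smul, one_smul,
        (hmk0 _).2 (Dvd.intro_left _ rfl), sub_zero]
    have hsurj : Function.Surjective (LinearMap.toSpanSingleton A P p) := by
      intro x
      obtain ⟨c, hc⟩ := Ideal.Quotient.mk_surjective (g x)
      obtain ⟨z, hz⟩ := (hfg (x - c • p)).1 (by rw [map_sub, map_smul, hp, hmk, hc, sub_self])
      obtain ⟨d, rfl⟩ := Ideal.Quotient.mk_surjective z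
      refine ⟨c + d * (b * t), ?_⟩
      rw [LinearMap.toSpanSingleton_apply, add_smul, mul_smul, ← h1, ← map_smul, hmk, hz]
      abel
    have hkerp : LinearMap.ker (LinearMap.toSpanSingleton A P p) = Ideal.span {t ^ (i + 1)} := by
      ext x
      rw [LinearMap.mem_ker, LinearMap.toSpanSingleton_apply, Ideal.mem_span_singleton]
      have hx : ∀ c : A, (c * t) • p = 0 ↔ t ^ i ∣ c := by
        intro c
        rw [mul_smul, ← ha, ← map_smul, map_eq_zero_iff f hf, ← hmk, smul_smul, hmk0]
        exact ⟨hco.symm.dvd_of_dvd_mul_right, fun h => h.mul_right a⟩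
      constructor
      · intro h
        obtain ⟨c, rfl⟩ : t ∣ x := by
          rw [← pow_one t, ← hmk0, ← hp, ← map_smul, h, map_zero]
        rw [mul_comm, hx] at h
        rw [pow_succ']
        exact mul_dvd_mul_left t h
      · rintro ⟨c, rfl⟩
        rw [pow_succ, mul_right_comm, hx]
        exact dvd_mul_right _ _
    exact ⟨((Submodule.quotEquivOfEq _ _ hkerp.symm).trans
      (LinearMap.quotKerEquivOfSurjective _ hsurj)).symm⟩

end

section

variable {R : Type u} [CommRing R] {n : ℕ}

theorem ct_mk (hn : 0 < n) (p : R[X]) : ct R n hn (Ideal.Quotient.mk _ p) = p.eval 0 := rfl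

theorem ct_tn (hn : 0 < n) : ct R n hn (tn R n) = 0 := by
  rw [tn, ct_mk, eval_X]

theorem ct_surjective (hn : 0 < n) : Function.Surjective (ct R n hn) := fun r =>
  ⟨Ideal.Quotient.mk _ (C r), by rw [ct_mk, eval_C]⟩

theorem ct_eq_zero_iff (hn : 0 < n) (a : Rn R n) : ct R n hn a = 0 ↔ tn R n ∣ a := by
  constructor
  · obtain ⟨p, rfl⟩ := Ideal.Quotient.mk_surjective a
    intro h
    rw [ct_mk, ← coeff_zero_eq_eval_zero] at h
    exact map_dvd _ (X_dvd_iff.2 h)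
  · rintro ⟨b, rfl⟩
    rw [map_mul, ct_tn, zero_mul]

theorem tn_pow_dvd_of_mul_tn_eq_zero {i : ℕ} (hi : i + 1 ≤ n) {s : Rn R n} (hs : s * tn R n = 0) :
    tn R n ^ i ∣ s := by
  obtain ⟨p, rfl⟩ := Ideal.Quotient.mk_surjective s
  rw [tn, ← map_mul, Ideal.Quotient.eq_zero_iff_mem, Ideal.mem_span_singleton] at hs
  rw [tn, ← map_pow]
  refine map_dvd _ (X_pow_dvd_iff.2 fun d hd => ?_)
  rw [← coeff_mul_X]
  exact X_pow_dvd_iff.1 hs _ (by omega)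

theorem isCoprime_tn_pow_iff (hn : 0 < n) {i : ℕ} (hi : i ≠ 0) (a : Rn R n) :
    IsCoprime a (tn R n ^ i) ↔ IsUnit (ct R n hn a) := by
  constructor
  · rintro ⟨b, c, h⟩
    have := congrArg (ct R n hn) h
    rw [map_add, map_mul, map_mul, map_pow, ct_tn, zero_pow hi, mul_zero, add_zero, map_one] at this
    exact IsUnit.of_mul_eq_one_right _ this
  · intro h
    obtain ⟨r, hr⟩ := h.exists_left_inv
    obtain ⟨b, rfl⟩ := ct_surjective hn r
    rw [← map_mul, ← map_one (ct R n hn), ← sub_eq_zero, ← map_sub, ct_eq_zero_iff] at hr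
    obtain ⟨c, hc⟩ := hr
    exact IsCoprime.pow_right ⟨b, -c, by linear_combination hc⟩

/-- The constant term homomorphism `R[n]/(t^i) → R` (for `i > 0`). -/
def ctQuot (R : Type*) [CommRing R] (n : ℕ) (hn : 0 < n) (i : ℕ) (hi : i ≠ 0) : Rmod R n i →+* R :=
  Ideal.Quotient.lift _ (ct R n hn) (by
    intro a ha
    obtain ⟨c, rfl⟩ := Ideal.mem_span_singleton.1 ha
    rw [map_mul, map_pow, ct_tn, zero_pow hi, zero_mul])

theorem ctQuot_surjective (hn : 0 < n) {i : ℕ} (hi : i ≠ 0) :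
    Function.Surjective (ctQuot R n hn i hi) :=
  Ideal.Quotient.lift_surjective_of_surjective _ _ (ct_surjective hn)

end

set_option synthInstance.maxHeartbeats 1000000 in
set_option maxHeartbeats 2000000 in
/-- `Ext¹_{R[n]}(R, R[i]) ≅ R`, and under this isomorphism, an extension
`0 → R[i] → P → R → 0` of `R[n]`-modules with class `σ ∈ R` satisfies `P ≅ R[i+1]`
iff `σ` is a unit of `R`. (Here `R = R[1]` and `R[k]` are the `R[n]`-modules
`Rmod R n k = R[n]/(t^k)`, and the class of a short exact sequence is its
`extClass` in `Ext¹`.) -/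
theorem ext_R_Rmod_iso_and_extension_classification
    {R : Type u} [CommRing R] [IsDomain R] [IsNoetherianRing R]
    (n i : ℕ) (hn : 2 ≤ n) (hi1 : 1 ≤ i) (hi2 : i ≤ n - 1) :
    letI : HasDerivedCategory (ModuleCat.{u} (Rn R n)) := HasDerivedCategory.standard _
    letI : HasExt.{u + 1} (ModuleCat.{u} (Rn R n)) := hasExt_of_hasDerivedCategory _
    ∃ e : Abelian.Ext.{u + 1} (ModuleCat.of (Rn R n) (Rmod R n 1))
          (ModuleCat.of (Rn R n) (Rmod R n i)) 1 ≃+ R,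
      ∀ (P : ModuleCat.{u} (Rn R n))
        (f : ModuleCat.of (Rn R n) (Rmod R n i) ⟶ P)
        (g : P ⟶ ModuleCat.of (Rn R n) (Rmod R n 1))
        (w : f ≫ g = 0)
        (hS : (ShortComplex.mk f g w).ShortExact),
        (Nonempty (P ≅ ModuleCat.of (Rn R n) (Rmod R n (i + 1)))) ↔
          IsUnit (e hS.extClass) := by
  let : HasDerivedCategory (ModuleCat.{u} (Rn R n)) := HasDerivedCategory.standard _
  let : HasExt.{u + 1} (ModuleCat.{u} (Rn R n)) := hasExt_of_hasDerivedCategory _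
  have hn0 : 0 < n := by omega
  have hi0 : i ≠ 0 := by omega
  have hker : ∀ x : Rmod R n i, ctQuot R n hn0 i hi0 x = 0 ↔ ∃ z, tn R n • z = x := by
    intro x
    obtain ⟨a, rfl⟩ := Ideal.Quotient.mk_surjective x
    constructor
    · intro h
      obtain ⟨b, rfl⟩ := (ct_eq_zero_iff hn0 a).1 h
      exact ⟨Ideal.Quotient.mk _ b, rfl⟩
    · rintro ⟨z, hz⟩
      obtain ⟨b, rfl⟩ := Ideal.Quotient.mk_surjective z
      rw [← hz]
      exact (ct_eq_zero_iff hn0 _).2 (dvd_mul_right (tn R n) b)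
  have hann : ∀ s : Rn R n, s * tn R n = 0 → ∀ x : Rmod R n i, s • x = 0 := by
    intro s hs x
    obtain ⟨a, rfl⟩ := Ideal.Quotient.mk_surjective x
    refine Ideal.Quotient.eq_zero_iff_mem.2 (Ideal.mem_span_singleton.2 ?_)
    exact Dvd.dvd.mul_right (tn_pow_dvd_of_mul_tn_eq_zero (by omega) hs) a
  obtain ⟨e, he⟩ := exists_ext_one_quotient_span_singleton_addEquiv.{u, u + 1}
    (I := Ideal.span {tn R n ^ 1}) (by rw [pow_one]) hann (ctQuot R n hn0 i hi0).toAddMonoidHom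
    (ctQuot_surjective hn0 hi0) hker
  refine ⟨e, fun P f g w hS => ?_⟩
  have hf : Function.Injective f.hom := hS.moduleCat_injective_f
  have hg : Function.Surjective g.hom := hS.moduleCat_surjective_g
  have hfg : Function.Exact f.hom g.hom :=
    (ShortComplex.ShortExact.moduleCat_exact_iff_function_exact _).1 hS.exact
  obtain ⟨p, hp⟩ := hg (1 : Rmod R n 1)
  obtain ⟨y, hy⟩ := (hfg (tn R n • p)).1 (by
    rw [map_smul, hp]
    refine Ideal.Quotient.eq_zero_iff_mem.2 (Ideal.mem_span_singleton.2 ?_)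
    rw [pow_one]
    exact dvd_mul_right _ _)
  obtain ⟨a, rfl⟩ := Ideal.Quotient.mk_surjective y
  rw [he P f g w hS p _ hp hy]
  refine Iff.trans ?_ ((nonempty_linearEquiv_quotient_span_pow_succ_iff hf hfg hp hy).trans
    (isCoprime_tn_pow_iff hn0 hi0 a))
  exact ⟨fun ⟨E⟩ => ⟨E.toLinearEquiv⟩, fun ⟨E⟩ => ⟨E.toModuleIso⟩⟩
end
end

section
/- Let R be a commutative Noetherian integral domain, n a positive integer, and M a finitely generated R[n]-module. Then Ext¹_{R[n]}(M, R[n]) is a torsion R[n]-module: every element of Ext¹_{R[n]}(M, R[n]) is annihilated by some non-zero-divisor of R[n]. -/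
open Polynomial

noncomputable section

universe u

section Duality

variable (R : Type*) [CommRing R] (n : ℕ)

/-- The `R`-linear map `R[n] → R` taking the coefficient of `t^(n-1)`. -/
def topCoeff (hn : 0 < n) : Rn R n →ₗ[R] R :=
  (Submodule.liftQ ((Ideal.span {(X : R[X]) ^ n}).restrictScalars R) (lcoeff R (n - 1)) (by
    intro p hp
    obtain ⟨c, rfl⟩ := Ideal.mem_span_singleton.1 hp
    simp [coeff_X_pow_mul', Nat.sub_lt hn])) ∘ₗ
    (Submodule.Quotient.restrictScalarsEquiv R (Ideal.span {(X : R[X]) ^ n})).symm.toLinearMap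

variable {R n}

lemma topCoeff_mk (hn : 0 < n) (p : R[X]) :
    topCoeff R n hn (Ideal.Quotient.mk _ p) = p.coeff (n - 1) := rfl

lemma topCoeff_ext (hn : 0 < n) {a a' : Rn R n}
    (h : ∀ b, topCoeff R n hn (a * b) = topCoeff R n hn (a' * b)) : a = a' := by
  obtain ⟨p, rfl⟩ := Ideal.Quotient.mk_surjective a
  obtain ⟨q, rfl⟩ := Ideal.Quotient.mk_surjective a'
  rw [Ideal.Quotient.eq, Ideal.mem_span_singleton, X_pow_dvd_iff]
  intro d hd
  have := h (Ideal.Quotient.mk _ (X ^ (n - 1 - d)))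
  rw [← map_mul, ← map_mul, topCoeff_mk, topCoeff_mk, coeff_mul_X_pow', coeff_mul_X_pow',
    if_pos (by omega), if_pos (by omega), show n - 1 - (n - 1 - d) = d by omega] at this
  rw [coeff_sub, this, sub_self]

lemma exists_topCoeff_mul_eq (hn : 0 < n) (f : Rn R n →ₗ[R] R) :
    ∃ a, ∀ b, topCoeff R n hn (a * b) = f b := by
  let q : R[X] := ∑ i ∈ Finset.range n, C (f (Ideal.Quotient.mk _ (X ^ (n - 1 - i)))) * X ^ i
  have hq (i : ℕ) (hi : i < n) : q.coeff i = f (Ideal.Quotient.mk _ (X ^ (n - 1 - i))) := by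
    simp [q, coeff_X_pow, hi]
  refine ⟨Ideal.Quotient.mk _ q, fun b ↦ ?_⟩
  obtain ⟨p, rfl⟩ := Ideal.Quotient.mk_surjective b
  rw [← map_mul]
  let mkR : R[X] →ₗ[R] Rn R n := (Ideal.Quotient.mkₐ R (Ideal.span {(X : R[X]) ^ n})).toLinearMap
  have key : (topCoeff R n hn ∘ₗ mkR) ∘ₗ LinearMap.mulLeft R q = f ∘ₗ mkR := by
    ext j
    change topCoeff R n hn (Ideal.Quotient.mk _ (q * monomial j 1)) =
      f (Ideal.Quotient.mk _ (monomial j 1))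
    rw [topCoeff_mk, monomial_one_right_eq_X_pow, coeff_mul_X_pow']
    split_ifs with hj
    · rw [hq _ (by omega), show n - 1 - (n - 1 - j) = j by omega]
    · have : Ideal.Quotient.mk (Ideal.span {(X : R[X]) ^ n}) (X ^ j) = 0 := by
        rw [Ideal.Quotient.eq_zero_iff_mem, Ideal.mem_span_singleton]
        exact pow_dvd_pow _ (by omega)
      rw [this, map_zero]
  exact LinearMap.congr_fun key p

lemma algebraMap_Rn_mem_nonZeroDivisors [IsDomain R] {r : R} (hr : r ≠ 0) :
    algebraMap R (Rn R n) r ∈ nonZeroDivisors (Rn R n) := by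
  rw [mem_nonZeroDivisors_iff_right]
  intro a ha
  obtain ⟨p, rfl⟩ := Ideal.Quotient.mk_surjective a
  change Ideal.Quotient.mk _ p * Ideal.Quotient.mk _ (C r) = 0 at ha
  rw [← map_mul, Ideal.Quotient.eq_zero_iff_mem, Ideal.mem_span_singleton, X_pow_dvd_iff] at ha
  rw [Ideal.Quotient.eq_zero_iff_mem, Ideal.mem_span_singleton, X_pow_dvd_iff]
  intro d hd
  simpa [hr] using ha d hd

end Duality

/-- The fraction field of a domain satisfies Baer's criterion. -/
lemma baer_fractionRing (R : Type*) [CommRing R] [IsDomain R] :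
    Module.Baer R (FractionRing R) := by
  intro I g
  by_cases hI : I = ⊥
  · subst hI
    refine ⟨0, fun x hx ↦ ?_⟩
    obtain rfl : x = 0 := by simpa using hx
    exact (map_zero g).symm
  obtain ⟨a, ha, ha0⟩ := Submodule.exists_mem_ne_zero_of_ne_bot hI
  have ha' : algebraMap R (FractionRing R) a ≠ 0 := by simpa using ha0
  refine ⟨LinearMap.toSpanSingleton R _ (g ⟨a, ha⟩ / algebraMap R (FractionRing R) a),
    fun x hx ↦ ?_⟩
  have h : x • g ⟨a, ha⟩ = a • g ⟨x, hx⟩ := by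
    rw [← map_smul, ← map_smul]
    congr 1
    ext
    simp [mul_comm]
  rw [LinearMap.toSpanSingleton_apply, ← smul_div_assoc, h, Algebra.smul_def,
    mul_div_cancel_left₀ _ ha']

/-- Up to a nonzero scalar, `R`-linear forms extend from submodules of finite modules. -/
lemma exists_smul_extension {R : Type u} [CommRing R] [IsDomain R] {F : Type u} [AddCommGroup F]
    [Module R F] [Module.Finite R F] (N : Submodule R F) (f : N →ₗ[R] R) :
    ∃ r : R, r ≠ 0 ∧ ∃ g : F →ₗ[R] R, ∀ x : N, g x = r * f x := by
  classical
  obtain ⟨h, hh⟩ := Module.Baer.extension_property (baer_fractionRing R) N.subtype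
    N.injective_subtype (Algebra.linearMap R (FractionRing R) ∘ₗ f)
  obtain ⟨s, hs⟩ := Module.Finite.fg_top (R := R) (M := F)
  obtain ⟨r, hr⟩ := IsLocalization.exist_integer_multiples (nonZeroDivisors R) s h
  have hinj : Function.Injective (Algebra.linearMap R (FractionRing R)) :=
    IsFractionRing.injective R (FractionRing R)
  have hmem (x : F) : ((r : R) • h) x ∈ LinearMap.range (Algebra.linearMap R (FractionRing R)) := by
    have : ⊤ ≤ (LinearMap.range (Algebra.linearMap R (FractionRing R))).comap ((r : R) • h) := by
      rw [← hs, Submodule.span_le]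
      exact fun y hy ↦ hr y hy
    exact this Submodule.mem_top
  let e := LinearEquiv.ofInjective _ hinj
  refine ⟨r, nonZeroDivisors.coe_ne_zero r,
    e.symm.toLinearMap ∘ₗ (((r : R) • h).codRestrict _ hmem), fun x ↦ ?_⟩
  apply hinj
  have h1 := LinearMap.congr_fun hh x
  have h2 : (Algebra.linearMap R (FractionRing R)) (e.symm (((r : R) • h).codRestrict _ hmem x)) =
      ((r : R) • h) x := congrArg Subtype.val (e.apply_symm_apply _)
  refine h2.trans ?_
  simp only [LinearMap.comp_apply, Submodule.subtype_apply] at h1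
  rw [LinearMap.smul_apply, h1, ← map_smul, smul_eq_mul]

/-- Up to a nonzero scalar, `R[n]`-linear forms extend from submodules of finite modules. -/
lemma exists_smul_extension_Rn {R : Type u} [CommRing R] [IsDomain R] {n : ℕ} (hn : 0 < n)
    {F : Type u} [AddCommGroup F] [Module R F] [Module (Rn R n) F] [IsScalarTower R (Rn R n) F]
    [Module.Finite R F] (N : Submodule (Rn R n) F) (f : N →ₗ[Rn R n] Rn R n) :
    ∃ r : R, r ≠ 0 ∧ ∃ g : F →ₗ[Rn R n] Rn R n, ∀ x : N, g x = algebraMap R (Rn R n) r * f x := by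
  obtain ⟨r, hr, g, hg⟩ := exists_smul_extension (N.restrictScalars R)
    (topCoeff R n hn ∘ₗ (f.restrictScalars R : N →ₗ[R] Rn R n))
  choose G hG using fun x : F ↦ exists_topCoeff_mul_eq hn
    (g ∘ₗ (LinearMap.toSpanSingleton (Rn R n) F x).restrictScalars R)
  simp only [LinearMap.comp_apply, LinearMap.restrictScalars_apply,
    LinearMap.toSpanSingleton_apply] at hG
  refine ⟨r, hr, ⟨⟨G, fun x y ↦ ?_⟩, fun a x ↦ ?_⟩, fun x ↦ ?_⟩
  · refine topCoeff_ext hn fun b ↦ ?_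
    rw [add_mul, map_add, hG, hG, hG, smul_add, map_add]
  · refine topCoeff_ext hn fun b ↦ ?_
    change topCoeff R n hn (G (a • x) * b) = topCoeff R n hn (a * G x * b)
    rw [mul_comm a, mul_assoc, hG, hG, mul_comm a, mul_smul]
  · refine topCoeff_ext hn fun b ↦ ?_
    change topCoeff R n hn (G x * b) = _
    rw [hG, mul_assoc, ← Algebra.smul_def, (topCoeff R n hn).map_smul, mul_comm, smul_eq_mul]
    refine (hg (b • x)).trans ?_
    change r * topCoeff R n hn (f (b • x)) = _
    rw [f.map_smul, smul_eq_mul]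

/-- Given a projective presentation of a finite `R[n]`-module, every cocycle with values in `R[n]`
becomes a coboundary after multiplication by a nonzero element of `R`. -/
lemma exists_smul_eq_comp {R : Type u} [CommRing R] [IsDomain R] {n : ℕ} (hn : 0 < n)
    {M P₀ P₁ : Type u} [AddCommGroup M] [Module (Rn R n) M] [Module.Finite (Rn R n) M]
    [AddCommGroup P₀] [Module (Rn R n) P₀] [Module.Projective (Rn R n) P₀]
    [AddCommGroup P₁] [Module (Rn R n) P₁]
    (d : P₁ →ₗ[Rn R n] P₀) (p : P₀ →ₗ[Rn R n] M) (hp : Function.Surjective p)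
    (hdp : LinearMap.range d = LinearMap.ker p) (z : P₁ →ₗ[Rn R n] Rn R n)
    (hz : LinearMap.ker d ≤ LinearMap.ker z) :
    ∃ r : R, r ≠ 0 ∧ ∃ w : P₀ →ₗ[Rn R n] Rn R n, w ∘ₗ d = algebraMap R (Rn R n) r • z := by
  have : Module.Finite R (Rn R n) := (monic_X_pow n).finite_quotient
  obtain ⟨k, q, hq⟩ := Module.Finite.exists_fin' (Rn R n) M
  obtain ⟨s, hs⟩ := Module.projective_lifting_property p q hp
  obtain ⟨u, hu⟩ := Module.projective_lifting_property q p hq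
  let φ : LinearMap.range d →ₗ[Rn R n] Rn R n :=
    (LinearMap.ker d).liftQ z hz ∘ₗ d.quotKerEquivRange.symm.toLinearMap
  have hφ (y : P₁) : φ ⟨d y, y, rfl⟩ = z y := by
    have : d.quotKerEquivRange.symm ⟨d y, y, rfl⟩ = (LinearMap.ker d).mkQ y :=
      d.quotKerEquivRange_symm_apply_image y _
    simp [φ, this]
  have hs' (x : LinearMap.ker q) : s x ∈ LinearMap.range d := by
    rw [hdp, LinearMap.mem_ker, ← LinearMap.comp_apply, hs]
    exact x.2
  have hv (x : P₀) : (LinearMap.id - s ∘ₗ u : P₀ →ₗ[Rn R n] P₀) x ∈ LinearMap.range d := by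
    have h1 := LinearMap.congr_fun hs (u x)
    have h2 := LinearMap.congr_fun hu x
    rw [LinearMap.comp_apply] at h1 h2
    rw [hdp, LinearMap.mem_ker]
    simp [h1, h2]
  obtain ⟨r, hr, g, hg⟩ := exists_smul_extension_Rn hn (LinearMap.ker q)
    (φ ∘ₗ (s ∘ₗ (LinearMap.ker q).subtype).codRestrict _ hs')
  refine ⟨r, hr, algebraMap R (Rn R n) r • (φ ∘ₗ (LinearMap.id - s ∘ₗ u : P₀ →ₗ[Rn R n] P₀).codRestrict _ hv) +
    g ∘ₗ u, LinearMap.ext fun y ↦ ?_⟩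
  have hy : u (d y) ∈ LinearMap.ker q := by
    rw [LinearMap.mem_ker, ← LinearMap.comp_apply, hu, ← LinearMap.mem_ker, ← hdp]
    exact ⟨y, rfl⟩
  have h1 := hg ⟨u (d y), hy⟩
  simp only [LinearMap.comp_apply, LinearMap.add_apply, LinearMap.smul_apply, smul_eq_mul] at h1 ⊢
  have h2 : (LinearMap.id - s ∘ₗ u : P₀ →ₗ[Rn R n] P₀).codRestrict _ hv (d y) +
      (s ∘ₗ (LinearMap.ker q).subtype).codRestrict _ hs' ⟨u (d y), hy⟩ = ⟨d y, y, rfl⟩ :=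
    Subtype.ext (sub_add_cancel (d y) (s (u (d y))))
  rw [h1, ← mul_add, ← map_add, h2, hφ]

open CategoryTheory in
/-- Homology is torsion if every cycle has a regular multiple which is a boundary. -/
lemma isTorsion_homology {A : Type*} [CommRing A] {S : ShortComplex (ModuleCat.{u} A)}
    (h : ∀ z : S.X₂, S.g z = 0 → ∃ a ∈ nonZeroDivisors A, ∃ w : S.X₁, S.f w = a • z) :
    Module.IsTorsion A S.homology := by
  intro x
  obtain ⟨c, rfl⟩ := (ModuleCat.epi_iff_surjective S.homologyπ).1 inferInstance x
  obtain ⟨a, ha, w, hw⟩ := h (S.iCycles c) (by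
    rw [← ConcreteCategory.comp_apply, S.iCycles_g]; rfl)
  refine ⟨⟨a, ha⟩, ?_⟩
  have hc : S.toCycles w = a • c := by
    apply (ModuleCat.mono_iff_injective S.iCycles).1 inferInstance
    rw [← ConcreteCategory.comp_apply, S.toCycles_i, hw, map_smul]
  change a • S.homologyπ c = 0
  rw [← map_smul, ← hc, ← ConcreteCategory.comp_apply, S.toCycles_comp_homologyπ]
  rfl

open CategoryTheory in
/-- The first cohomology of the dual of a projective resolution of a finite `R[n]`-module is
torsion. -/
lemma isTorsion_homology_linearYonedaObj {R : Type u} [CommRing R] [IsDomain R] {n : ℕ}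
    (hn : 0 < n) {M : Type u} [AddCommGroup M] [Module (Rn R n) M] [Module.Finite (Rn R n) M]
    (P : ProjectiveResolution (ModuleCat.of (Rn R n) M)) :
    Module.IsTorsion (Rn R n) ((P.complex.linearYonedaObj (Rn R n)
      (ModuleCat.of (Rn R n) (Rn R n))).homology 1) := by
  let K := P.complex.linearYonedaObj (Rn R n) (ModuleCat.of (Rn R n) (Rn R n))
  let e := (K.homologyIsoSc' 0 1 2 (by simp) (by simp)).toLinearEquiv
  have htors : Module.IsTorsion (Rn R n) (K.sc' 0 1 2).homology := by
    refine isTorsion_homology fun (z : P.complex.X 1 ⟶ ModuleCat.of (Rn R n) (Rn R n)) hz ↦ ?_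
    have hz' : P.complex.d 2 1 ≫ z = 0 := hz
    have hexact := P.exact_succ 0
    rw [ShortComplex.moduleCat_exact_iff_range_eq_ker] at hexact
    have hexact₀ := ShortComplex.exact_of_g_is_cokernel
      (ShortComplex.mk _ _ P.complex_d_comp_π_f_zero) P.isColimitCokernelCofork
    rw [ShortComplex.moduleCat_exact_iff_range_eq_ker] at hexact₀
    have : Module.Projective (Rn R n) (P.complex.X 0) :=
      (IsProjective.iff_projective _).2 (P.projective 0)
    obtain ⟨r, hr, w, hw⟩ := exists_smul_eq_comp hn (P.complex.d 1 0).hom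
      (show P.complex.X 0 →ₗ[Rn R n] M from (P.π.f 0).hom)
      ((ModuleCat.epi_iff_surjective _).1 inferInstance) hexact₀ z.hom (by
        refine hexact.symm.trans_le ?_
        rintro _ ⟨y, rfl⟩
        exact LinearMap.congr_fun (congrArg ModuleCat.Hom.hom hz') y)
    exact ⟨_, algebraMap_Rn_mem_nonZeroDivisors hr, ModuleCat.ofHom w, ModuleCat.hom_ext hw⟩
  intro x
  obtain ⟨a, ha⟩ := @htors (e x)
  refine ⟨a, e.injective ?_⟩
  rw [map_zero, ← ha]
  exact map_smul e (a : Rn R n) x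

/-- For a finitely generated `R[n]`-module `M`, the module `Ext¹_{R[n]}(M, R[n])` is a
torsion module: every element is annihilated by a non-zero-divisor of `R[n]`. -/
theorem ext_one_isTorsion
    {R : Type u} [CommRing R] [IsDomain R] [IsNoetherianRing R]
    (n : ℕ) (hn : 0 < n)
    (M : Type u) [AddCommGroup M] [Module (Rn R n) M] [Module.Finite (Rn R n) M] :
    Module.IsTorsion (Rn R n)
      (((Ext (Rn R n) (ModuleCat (Rn R n)) 1).obj
          (Opposite.op (ModuleCat.of (Rn R n) M))).obj
        (ModuleCat.of (Rn R n) (Rn R n))) := by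
  let P := CategoryTheory.projectiveResolution (ModuleCat.of (Rn R n) M)
  intro x
  let e := (P.isoExt (R := Rn R n) 1 (ModuleCat.of (Rn R n) (Rn R n))).toLinearEquiv
  obtain ⟨a, ha⟩ := @isTorsion_homology_linearYonedaObj _ _ _ _ hn _ _ _ _ P (e x)
  refine ⟨a, e.injective ?_⟩
  rw [map_zero, ← ha]
  exact map_smul e (a : Rn R n) x
end
end

section
/- Let R be a commutative Noetherian integral domain, n ≥ 2 an integer, and M an R[n]-module. For 0 ≤ i ≤ n-2, let μ_i : G_i(M) → G_{i+1}(M) be the surjective map induced by multiplication by t, and let λ_{i+1} : G^{(i+2)}(M) → G^{(i+1)}(M) be the injective map induced by multiplication by t. Then there is a canonical isomorphism of R-modules ker(μ_i) ≅ coker(λ_{i+1}). -/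
open Polynomial

noncomputable section

section KerCoker

variable (R : Type*) [CommRing R] (n : ℕ) (M : Type*) [AddCommGroup M] [Module (Rn R n) M]

lemma mem_kt {i : ℕ} {x : M} : x ∈ kt R n M i ↔ tn R n ^ i • x = 0 := Iff.rfl

/-- The map `M^{(i+1)} → G_i(M)` induced by multiplication by `t^i`. -/
def ktToGi (i : ℕ) : kt R n M (i + 1) →ₗ[Rn R n] Gi R n M i :=
  (Submodule.mkQ _).comp
    ((LinearMap.lsmul (Rn R n) M (tn R n ^ i)).rangeRestrict.comp (kt R n M (i + 1)).subtype)

lemma ktToGi_eq_zero_iff {i : ℕ} (x : kt R n M (i + 1)) :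
    ktToGi R n M i x = 0 ↔ ∃ y : M, tn R n ^ (i + 1) • y = tn R n ^ i • (x : M) :=
  Submodule.Quotient.mk_eq_zero _

lemma muMap_mk_eq_zero_iff {i : ℕ} (x : tMi R n M i) :
    muMap R n M i (Submodule.Quotient.mk x) = 0 ↔
      ∃ y : M, tn R n ^ (i + 2) • y = tn R n • (x : M) :=
  Submodule.Quotient.mk_eq_zero _

lemma range_ktToGi (i : ℕ) :
    LinearMap.range (ktToGi R n M i) = LinearMap.ker (muMap R n M i) := by
  ext z
  constructor
  · rintro ⟨x, rfl⟩
    refine (muMap_mk_eq_zero_iff R n M _).2 ⟨0, ?_⟩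
    have hx := (mem_kt R n M).1 x.2
    change _ = tn R n • tn R n ^ i • (x : M)
    rw [smul_zero, smul_smul, ← pow_succ', hx]
  · intro hz
    obtain ⟨⟨_, m, rfl⟩, rfl⟩ := Submodule.Quotient.mk_surjective _ z
    obtain ⟨y, hy⟩ := (muMap_mk_eq_zero_iff R n M _).1 hz
    change _ = tn R n • tn R n ^ i • m at hy
    rw [smul_smul, ← pow_succ'] at hy
    refine ⟨⟨m - tn R n • y, ?_⟩, ?_⟩
    · rw [mem_kt, smul_sub, smul_smul, ← pow_succ, hy, sub_self]
    · refine (Submodule.Quotient.eq _).2 ⟨-y, ?_⟩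
      change tn R n ^ (i + 1) • -y = tn R n ^ i • (m - tn R n • y) - tn R n ^ i • m
      rw [smul_sub, smul_smul, ← pow_succ, smul_neg]
      abel

/-- The quotient map `M^{(i+1)} → coker(λ_{i+1})`. -/
def ktToCoker (i : ℕ) :
    kt R n M (i + 1) →ₗ[Rn R n] Gup R n M i ⧸ LinearMap.range (lamMap R n M i) :=
  (Submodule.mkQ _).comp (Submodule.mkQ _)

lemma ktToCoker_surjective (i : ℕ) : Function.Surjective (ktToCoker R n M i) :=
  (Submodule.mkQ_surjective _).comp (Submodule.mkQ_surjective _)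

lemma ktToCoker_eq_zero_iff {i : ℕ} (x : kt R n M (i + 1)) :
    ktToCoker R n M i x = 0 ↔
      ∃ y ∈ kt R n M (i + 2), tn R n • y - (x : M) ∈ kt R n M i := by
  refine (Submodule.Quotient.mk_eq_zero _).trans ⟨?_, ?_⟩
  · rintro ⟨w, hw⟩
    obtain ⟨y, rfl⟩ := Submodule.Quotient.mk_surjective _ w
    exact ⟨y, y.2,
      (Submodule.Quotient.eq (Submodule.comap (kt R n M (i + 1)).subtype (kt R n M i))).1 hw⟩
  · rintro ⟨y, hy, hxy⟩
    exact ⟨Submodule.Quotient.mk ⟨y, hy⟩, (Submodule.Quotient.eq _).2 hxy⟩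

lemma ker_ktToGi (i : ℕ) :
    LinearMap.ker (ktToGi R n M i) = LinearMap.ker (ktToCoker R n M i) := by
  ext x
  rw [LinearMap.mem_ker, LinearMap.mem_ker, ktToGi_eq_zero_iff, ktToCoker_eq_zero_iff]
  have hx := (mem_kt R n M).1 x.2
  have key (y : M) : tn R n • y - (x : M) ∈ kt R n M i ↔
      tn R n ^ (i + 1) • y = tn R n ^ i • (x : M) := by
    rw [mem_kt, smul_sub, smul_smul, ← pow_succ, sub_eq_zero]
  simp only [key]
  refine ⟨fun ⟨y, hy⟩ => ⟨y, ?_, hy⟩, fun ⟨y, _, hy⟩ => ⟨y, hy⟩⟩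
  rw [mem_kt, pow_succ', mul_smul, hy, smul_smul, ← pow_succ', hx]

/-- The canonical `R[n]`-linear isomorphism `ker(μ_i) ≅ coker(λ_{i+1})`, sending the class of
`t^i x`, for `x ∈ M^{(i+1)}`, to the class of `x`. -/
def kerMuEquivCokerLam (i : ℕ) :
    LinearMap.ker (muMap R n M i) ≃ₗ[Rn R n]
      Gup R n M i ⧸ LinearMap.range (lamMap R n M i) :=
  (LinearEquiv.ofEq _ _ (range_ktToGi R n M i)).symm ≪≫ₗ
    (ktToGi R n M i).quotKerEquivRange.symm ≪≫ₗ
    Submodule.quotEquivOfEq _ _ (ker_ktToGi R n M i) ≪≫ₗ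
    (ktToCoker R n M i).quotKerEquivOfSurjective (ktToCoker_surjective R n M i)

end KerCoker

/-- For `0 ≤ i ≤ n-2`, there is a canonical isomorphism of `R`-modules
`ker(μ_i) ≅ coker(λ_{i+1})`, where `μ_i : G_i(M) → G_{i+1}(M)` and
`λ_{i+1} : G^{(i+2)}(M) → G^{(i+1)}(M)` are induced by multiplication by `t`. -/
theorem ker_mu_iso_coker_lam
    {R : Type*} [CommRing R] [IsDomain R] [IsNoetherianRing R]
    (n : ℕ) (hn : 2 ≤ n)
    (M : Type*) [AddCommGroup M] [Module (Rn R n) M]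
    (i : ℕ) (hi : i ≤ n - 2) :
    letI : Module R (LinearMap.ker (muMap R n M i)) :=
      Module.compHom _ (algebraMap R (Rn R n))
    letI : Module R (Gup R n M i ⧸ LinearMap.range (lamMap R n M i)) :=
      Module.compHom _ (algebraMap R (Rn R n))
    Nonempty
      ((LinearMap.ker (muMap R n M i)) ≃ₗ[R]
        (Gup R n M i ⧸ LinearMap.range (lamMap R n M i))) := by
  let e := kerMuEquivCokerLam R n M i
  let : Module R (LinearMap.ker (muMap R n M i)) :=
    Module.compHom _ (algebraMap R (Rn R n))
  let : Module R (Gup R n M i ⧸ LinearMap.range (lamMap R n M i)) :=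
    Module.compHom _ (algebraMap R (Rn R n))
  exact ⟨{ e.toAddEquiv with map_smul' := fun r x => e.map_smul (algebraMap R (Rn R n) r) x }⟩
end
end

section
/- Let R be a commutative Noetherian integral domain, n and p positive integers, and (x_1,...,x_p) a regular sequence in R[n] = R[t]/(t^n). Then the ideal I of R[n] generated by x_1,...,x_p is a balanced R[n]-module, i.e. t^i I = {a ∈ I : t^{n-i} a = 0} for every 1 ≤ i ≤ n. -/
open Polynomial

noncomputable section

lemma tn_pow_self (R : Type*) [CommRing R] (n : ℕ) : tn R n ^ n = 0 := by
  rw [tn, ← map_pow]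
  exact Ideal.Quotient.eq_zero_iff_mem.mpr (Ideal.mem_span_singleton_self _)

lemma tn_pow_dvd_of_tn_pow_mul_eq_zero {R : Type*} [CommRing R] {n i : ℕ} (hi : i ≤ n)
    {a : Rn R n} (ha : tn R n ^ i * a = 0) : tn R n ^ (n - i) ∣ a := by
  obtain ⟨f, rfl⟩ := Ideal.Quotient.mk_surjective a
  rw [tn, ← map_pow, ← map_mul, Ideal.Quotient.eq_zero_iff_mem,
    Ideal.mem_span_singleton] at ha
  obtain ⟨g, hg⟩ := ha
  refine ⟨Ideal.Quotient.mk _ g, ?_⟩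
  rw [tn, ← map_pow, ← map_mul]
  congr 1
  apply (monic_X_pow i).isRegular.left
  change X ^ i * f = X ^ i * (X ^ (n - i) * g)
  rw [hg, ← mul_assoc, ← pow_add, Nat.add_sub_cancel' hi]

/-- Exactness of multiplication by the complementary powers `t ^ i`, `t ^ (n - i)` passes from a
ring to its quotient by a weakly regular sequence. -/
lemma exists_sub_pow_mul_mem_ofList {A : Type*} [CommRing A] {t : A} {n : ℕ} (ht : t ^ n = 0)
    (hA : ∀ i ≤ n, ∀ a, t ^ i * a = 0 → t ^ (n - i) ∣ a) (rs : List A)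
    (hrs : RingTheory.Sequence.IsWeaklyRegular A rs) {i : ℕ} (hi : i ≤ n) {b : A}
    (hb : t ^ i * b ∈ Ideal.ofList rs) : ∃ e, b - t ^ (n - i) * e ∈ Ideal.ofList rs := by
  induction rs using List.reverseRecOn generalizing i b with
  | nil =>
    obtain ⟨e, rfl⟩ := hA i hi b (by simpa using hb)
    exact ⟨e, by simp⟩
  | append_singleton rs x ih =>
    rw [RingTheory.Sequence.isWeaklyRegular_append_iff,
      RingTheory.Sequence.isWeaklyRegular_singleton_iff] at hrs
    obtain ⟨hrs, hx⟩ := hrs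
    have hx' : ∀ a, x * a ∈ Ideal.ofList rs → a ∈ Ideal.ofList rs := fun a ha ↦ by
      simpa using mem_of_isSMulRegular_quotient_of_smul_mem hx (by simpa using ha)
    rw [Ideal.ofList_append, Ideal.ofList_singleton] at hb ⊢
    obtain ⟨u, hu, v, hv, huv⟩ := Submodule.mem_sup.mp hb
    obtain ⟨c, rfl⟩ := Ideal.mem_span_singleton.mp hv
    have hc : t ^ (n - i) * c ∈ Ideal.ofList rs := by
      refine hx' _ ?_
      have h : t ^ (n - i) * t ^ i = 0 := by rw [← pow_add, Nat.sub_add_cancel hi, ht]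
      have : x * (t ^ (n - i) * c) = -(t ^ (n - i) * u) := by
        linear_combination t ^ (n - i) * huv + b * h
      rw [this]
      exact neg_mem (Ideal.mul_mem_left _ _ hu)
    obtain ⟨d, hd⟩ := ih hrs (Nat.sub_le n i) hc
    rw [Nat.sub_sub_self hi] at hd
    have hbd : t ^ i * (b - x * d) ∈ Ideal.ofList rs := by
      have : t ^ i * (b - x * d) = u + x * (c - t ^ i * d) := by linear_combination -huv
      rw [this]
      exact add_mem hu (Ideal.mul_mem_left _ _ hd)
    obtain ⟨e, he⟩ := ih hrs hi hbd
    refine ⟨e, Submodule.mem_sup.mpr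
      ⟨_, he, x * d, Ideal.mul_mem_right _ _ (Ideal.mem_span_singleton_self x), by ring⟩⟩

open RingTheory.Sequence in
/-- If `(x_1,...,x_p)` is a regular sequence in `R[n]`, then the ideal `I` generated by
`x_1,...,x_p` is a balanced `R[n]`-module: `t^i I = {a ∈ I : t^{n-i} a = 0}` for
`1 ≤ i ≤ n`. -/
theorem regular_ideal_balanced
    {R : Type*} [CommRing R] [IsDomain R] [IsNoetherianRing R]
    (n p : ℕ) (hn : 0 < n) (hp : 0 < p)
    (x : Fin p → Rn R n)
    (hreg : IsWeaklyRegular (Rn R n) (List.ofFn x)) :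
    ∀ i : ℕ, 1 ≤ i → i ≤ n →
      tMi R n (Ideal.span (Set.range x)) i =
        kt R n (Ideal.span (Set.range x)) (n - i) := by
  have hI : Ideal.span (Set.range x) = Ideal.ofList (List.ofFn x) := by
    simp only [Ideal.ofList, List.mem_ofFn]
    rfl
  intro i _ hi
  ext ⟨a, ha⟩
  simp only [tMi, kt, LinearMap.mem_range, LinearMap.mem_ker, LinearMap.lsmul_apply,
    Subtype.ext_iff, Submodule.coe_smul, smul_eq_mul, ZeroMemClass.coe_zero]
  constructor
  · rintro ⟨b, rfl⟩
    rw [← mul_assoc, ← pow_add, Nat.sub_add_cancel hi, tn_pow_self, zero_mul]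
  · intro h
    obtain ⟨c, rfl⟩ := tn_pow_dvd_of_tn_pow_mul_eq_zero (Nat.sub_le n i) h
    rw [Nat.sub_sub_self hi] at ha ⊢
    obtain ⟨e, he⟩ := exists_sub_pow_mul_mem_ofList (tn_pow_self R n)
      (fun _ hj _ ↦ tn_pow_dvd_of_tn_pow_mul_eq_zero hj) _ hreg hi (hI ▸ ha)
    refine ⟨⟨_, hI ▸ he⟩, ?_⟩
    rw [mul_sub, ← mul_assoc, ← pow_add, Nat.add_sub_cancel' hi, tn_pow_self, zero_mul, sub_zero]
end
end

section
/- Let R be a 2-dimensional regular local ring containing ℂ with residue field ℂ, with maximal ideal m. Let A = R[t]/(t²), I = (t) ⊆ A, and let x, y ∈ A be elements whose images x₀, y₀ in R generate m. Let Ā, B̄, Ā', B̄' ∈ I, and let τ (resp. τ') denote the image of −y₀Ā + x₀B̄ (resp. −y₀Ā' + x₀B̄') in mI/m²I. Then the following are equivalent: (i) the ideals (x+Ā, y+B̄) and (x+Ā', y+B̄') of A are equal; (ii) τ = τ'; (iii) Ā'−Ā ∈ mI and B̄'−B̄ ∈ mI; (iv) the A-modules (x+Ā, y+B̄) and (x+Ā',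 y+B̄') are isomorphic. -/
open Polynomial

noncomputable section

section DoubleLocal

/-- The constant term homomorphism `A = R[2] → R`. -/
def ct2 (R : Type*) [CommRing R] : Rn R 2 →+* R := ct R 2 (by norm_num)

/-- The ideal `I = (t) ⊆ A = R[2]` (the ideal of `X ⊆ X₂` at the point). -/
def It (R : Type*) [CommRing R] : Ideal (Rn R 2) := Ideal.span {tn R 2}

/-- The ideal `𝔪I ⊆ A = R[2]`. -/
def mIt (R : Type*) [CommRing R] [IsLocalRing R] : Ideal (Rn R 2) :=
  Ideal.map (algebraMap R (Rn R 2)) (IsLocalRing.maximalIdeal R) * It R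

/-- The ideal `𝔪²I ⊆ A = R[2]`. -/
def m2It (R : Type*) [CommRing R] [IsLocalRing R] : Ideal (Rn R 2) :=
  (Ideal.map (algebraMap R (Rn R 2)) (IsLocalRing.maximalIdeal R)) ^ 2 * It R

end DoubleLocal

section RegularParameters

open IsLocalRing

variable {R : Type*} [CommRing R] [IsLocalRing R]

/-- A prime ideal containing `x` and a power of `y`, where `𝔪 = (x, y)`, is `𝔪`. -/
lemma eq_maximalIdeal_of_mem_of_pow_mem {x y : R} (hm : maximalIdeal R = Ideal.span {x, y})
    {p : Ideal R} [hp : p.IsPrime] (hx : x ∈ p) {n : ℕ} (hy : y ^ n ∈ p) :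
    p = maximalIdeal R := by
  refine le_antisymm (le_maximalIdeal hp.ne_top) ?_
  rw [hm, Ideal.span_le]
  rintro z (rfl | rfl)
  exacts [hx, hp.mem_of_pow_mem _ hy]

lemma height_maximalIdeal_eq_two (hdim : ringKrullDim R = 2) : (maximalIdeal R).height = 2 := by
  have := IsLocalRing.maximalIdeal_height_eq_ringKrullDim (R := R)
  rw [hdim] at this
  exact WithBot.coe_injective this

variable [IsNoetherianRing R]

/-- Ideals of a Noetherian local ring are closed in the `𝔪`-adic topology. -/
lemma exists_notMem_sup_pow {I : Ideal R} {r : R} (hr : r ∉ I) :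
    ∃ n : ℕ, r ∉ I ⊔ maximalIdeal R ^ n := by
  by_contra! h
  by_cases hI : I = ⊤
  · exact hr (hI ▸ Submodule.mem_top)
  have := Ideal.Quotient.nontrivial_iff.mpr hI
  have hbot := Ideal.iInf_pow_smul_eq_bot_of_isLocalRing (M := R ⧸ I) (maximalIdeal R)
    (Ideal.IsPrime.ne_top inferInstance)
  refine hr (Ideal.Quotient.eq_zero_iff_mem.mp ?_)
  rw [← Submodule.mem_bot R, ← hbot, Submodule.mem_iInf]
  intro n
  obtain ⟨i, hi, j, hj, rfl⟩ := Submodule.mem_sup.mp (h n)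
  rw [map_add, Ideal.Quotient.eq_zero_iff_mem.mpr hi, zero_add]
  have := Submodule.smul_mem_smul hj (Submodule.mem_top (x := (1 : R ⧸ I)))
  rwa [Algebra.smul_def, mul_one] at this

/-- If `𝔪 = (x, y)`, an element outside `(x)` is congruent modulo `x` to a unit times a power
of `y`. -/
lemma exists_eq_mul_add_pow_mul_of_notMem_span {x y r : R}
    (hm : maximalIdeal R = Ideal.span {x, y}) (hr : r ∉ Ideal.span {x}) :
    ∃ (a u : R) (n : ℕ), IsUnit u ∧ r = x * a + y ^ n * u := by
  classical
  have hex : ∃ n : ℕ, ¬ ∃ a b : R, r = x * a + y ^ n * b := by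
    obtain ⟨n, hn⟩ := exists_notMem_sup_pow hr
    refine ⟨n, ?_⟩
    rintro ⟨a, b, rfl⟩
    have hy : y ∈ maximalIdeal R := hm ▸ Ideal.subset_span (by simp)
    exact hn (Submodule.add_mem_sup (Ideal.mul_mem_right _ _ (Ideal.mem_span_singleton_self x))
      (Ideal.mul_mem_right _ _ (Ideal.pow_mem_pow hy n)))
  have hpos : Nat.find hex ≠ 0 := fun h ↦ by
    have := Nat.find_spec hex
    rw [h] at this
    exact this ⟨0, r, by simp⟩
  obtain ⟨n, hn⟩ := Nat.exists_eq_succ_of_ne_zero hpos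
  obtain ⟨a, u, h⟩ := not_not.mp (Nat.find_min hex (m := n) (by omega))
  refine ⟨a, u, n, ?_, h⟩
  by_contra hu
  have hu' : u ∈ Ideal.span {x, y} := hm ▸ (mem_maximalIdeal u).mpr hu
  obtain ⟨c, d, hcd⟩ := Ideal.mem_span_pair.mp hu'
  have := Nat.find_spec hex
  rw [hn] at this
  exact this ⟨a + y ^ n * c, d, by rw [h, ← hcd, Nat.succ_eq_add_one]; ring⟩

lemma pow_notMem_span_singleton {x y : R} (hdim : ringKrullDim R = 2)
    (hm : maximalIdeal R = Ideal.span {x, y}) (n : ℕ) : y ^ n ∉ Ideal.span {x} := by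
  intro h
  have hmin : maximalIdeal R ∈ (Ideal.span {x}).minimalPrimes := by
    refine ⟨⟨inferInstance, ?_⟩, fun q hq _ ↦ ?_⟩
    · rw [hm]
      exact Ideal.span_mono (by simp)
    · have := hq.1
      exact (eq_maximalIdeal_of_mem_of_pow_mem hm (hq.2 (Ideal.mem_span_singleton_self x))
        (hq.2 h)).ge
  have := Ideal.height_le_one_of_isPrincipal_of_mem_minimalPrimes _ _ hmin
  rw [height_maximalIdeal_eq_two hdim] at this
  exact absurd this (by decide)

/-- In a two-dimensional regular local ring with `𝔪 = (x, y)`, the ideal `(x)` is prime. -/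
lemma isPrime_span_singleton {x y : R} (hdim : ringKrullDim R = 2)
    (hm : maximalIdeal R = Ideal.span {x, y}) : (Ideal.span {x}).IsPrime := by
  refine ⟨fun h ↦ pow_notMem_span_singleton hdim hm 0 (h ▸ Submodule.mem_top), ?_⟩
  intro r s hrs
  by_contra! h
  obtain ⟨a, u, n, hu, rfl⟩ := exists_eq_mul_add_pow_mul_of_notMem_span hm h.1
  obtain ⟨b, v, k, hv, rfl⟩ := exists_eq_mul_add_pow_mul_of_notMem_span hm h.2
  refine pow_notMem_span_singleton hdim hm (n + k) ?_
  rw [← Ideal.mul_unit_mem_iff_mem _ (hu.mul hv)]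
  obtain ⟨c, hc⟩ := Ideal.mem_span_singleton.mp hrs
  exact Ideal.mem_span_singleton.mpr
    ⟨c - (a * (x * b + y ^ k * v) + y ^ n * u * b), by linear_combination hc⟩

/-- A regular parameter of a two-dimensional regular local ring is not a zero divisor. -/
lemma eq_zero_of_regular_parameter_mul_eq_zero {x y : R} (hdim : ringKrullDim R = 2)
    (hm : maximalIdeal R = Ideal.span {x, y}) {z : R} (hz : x * z = 0) : z = 0 := by
  by_contra hz0
  have hxm : x ∈ maximalIdeal R := hm ▸ Ideal.subset_span (by simp)
  have hfin : FiniteMultiplicity x z := by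
    obtain ⟨n, hn⟩ := exists_notMem_sup_pow (I := ⊥) (r := z) (by simpa using hz0)
    refine FiniteMultiplicity.def.mpr ⟨n, fun ⟨c, hc⟩ ↦ hn ?_⟩
    rw [bot_sup_eq, hc, pow_succ, mul_assoc]
    exact Ideal.mul_mem_right _ _ (Ideal.pow_mem_pow hxm n)
  obtain ⟨s, hzs, hs⟩ := hfin.exists_eq_pow_mul_and_not_dvd
  obtain ⟨a, u, n, hu, hsau⟩ :=
    exists_eq_mul_add_pow_mul_of_notMem_span hm (mt Ideal.mem_span_singleton.mp hs)
  have key : ∀ p : Ideal R, p.IsPrime → s ∈ p → x ∈ p → p = maximalIdeal R := by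
    intro p hp hsp hxp
    refine eq_maximalIdeal_of_mem_of_pow_mem hm hxp (n := n) ?_
    rw [← Ideal.mul_unit_mem_iff_mem _ hu]
    have : y ^ n * u = s - x * a := by rw [hsau]; ring
    rw [this]
    exact p.sub_mem hsp (p.mul_mem_right _ hxp)
  obtain ⟨p₁, hp₁, hlt₁, hh₁⟩ : ∃ p : Ideal R, p.IsPrime ∧ p < maximalIdeal R ∧ 1 ≤ p.height := by
    by_contra! h
    have : (maximalIdeal R).height ≤ 1 := Ideal.height_le_iff.mpr fun q hq hlt ↦ h q hq hlt
    rw [height_maximalIdeal_eq_two hdim] at this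
    exact absurd this (by decide)
  obtain ⟨p₀, hp₀, hlt₀⟩ : ∃ p : Ideal R, p.IsPrime ∧ p < p₁ := by
    by_contra! h
    have : p₁.height ≤ 0 := Ideal.height_le_iff.mpr fun q hq hlt ↦ absurd hlt (h q hq)
    exact absurd (hh₁.trans this) (by decide)
  by_cases hx₀ : x ∈ p₀
  · obtain ⟨r, hr₁, hr₀⟩ := SetLike.exists_of_lt hlt₀
    have hrx : r ∉ Ideal.span {x} :=
      fun h ↦ hr₀ ((Ideal.span_singleton_le_iff_mem _).mpr hx₀ h)
    obtain ⟨b, v, k, hv, rfl⟩ := exists_eq_mul_add_pow_mul_of_notMem_span hm hrx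
    have hx₁ := hlt₀.le hx₀
    refine hlt₁.ne (eq_maximalIdeal_of_mem_of_pow_mem hm hx₁ (n := k) ?_)
    rw [← Ideal.mul_unit_mem_iff_mem _ hv]
    exact (Ideal.add_mem_iff_right _ (p₁.mul_mem_right _ hx₁)).mp hr₁
  · have hs₀ : s ∈ p₀ := by
      have : x ^ (multiplicity x z + 1) * s ∈ p₀ := by
        rw [pow_succ', mul_assoc, ← hzs, hz]
        exact p₀.zero_mem
      exact (hp₀.mem_or_mem this).resolve_left fun h ↦ hx₀ (hp₀.mem_of_pow_mem _ h)
    have hmin : maximalIdeal R ∈ (p₀ ⊔ Ideal.span {x}).minimalPrimes := by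
      refine ⟨⟨inferInstance, sup_le (hlt₀.trans hlt₁).le
        ((Ideal.span_singleton_le_iff_mem _).mpr hxm)⟩, fun q hq _ ↦ ?_⟩
      exact (key q hq.1 (hq.2 (Ideal.mem_sup_left hs₀))
        (hq.2 (Ideal.mem_sup_right (Ideal.mem_span_singleton_self x)))).ge
    have hle := Ideal.map_height_le_one_of_mem_minimalPrimes hmin
    have hm' := Ideal.isPrime_map_quotientMk_of_isPrime (hlt₀.trans hlt₁).le
    have hp' := Ideal.isPrime_map_quotientMk_of_isPrime hlt₀.le
    have hcomap : ∀ q : Ideal R, p₀ ≤ q →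
        (q.map (Ideal.Quotient.mk p₀)).comap (Ideal.Quotient.mk p₀) = q := fun q hq ↦ by
      rw [Ideal.comap_map_of_surjective _ Ideal.Quotient.mk_surjective,
        ← RingHom.ker_eq_comap_bot, Ideal.mk_ker, sup_eq_left.mpr hq]
    have hlt' : p₁.map (Ideal.Quotient.mk p₀) < (maximalIdeal R).map (Ideal.Quotient.mk p₀) := by
      refine lt_of_le_of_ne (Ideal.map_mono hlt₁.le) fun h ↦ hlt₁.ne ?_
      rw [← hcomap p₁ hlt₀.le, h, hcomap _ (hlt₀.trans hlt₁).le]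
    have h0 : (p₁.map (Ideal.Quotient.mk p₀)).height < 1 := Ideal.height_le_iff.mp hle _ hp' hlt'
    have hbot : (⊥ : Ideal (R ⧸ p₀)) < p₁.map (Ideal.Quotient.mk p₀) := by
      refine bot_lt_iff_ne_bot.mpr fun h ↦ hlt₀.ne' ?_
      rw [← hcomap p₁ hlt₀.le, h, ← RingHom.ker_eq_comap_bot, Ideal.mk_ker]
    have := Ideal.height_le_iff.mp (Order.lt_one_iff_nonpos.mp h0) _ Ideal.isPrime_bot hbot
    exact absurd this (by simp)

/-- Regular parameters of a two-dimensional regular local ring have only the Koszul syzygy. -/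
lemma exists_eq_mul_of_mul_eq_mul {x y p q : R} (hdim : ringKrullDim R = 2)
    (hm : maximalIdeal R = Ideal.span {x, y}) (h : y * p = x * q) :
    ∃ w, p = x * w ∧ q = y * w := by
  have hprime := isPrime_span_singleton hdim hm
  have hp : p ∈ Ideal.span {x} :=
    (hprime.mem_or_mem (Ideal.mem_span_singleton.mpr ⟨q, h⟩)).resolve_left
      (by simpa using pow_notMem_span_singleton hdim hm 1)
  obtain ⟨w, rfl⟩ := Ideal.mem_span_singleton.mp hp
  refine ⟨w, rfl, sub_eq_zero.mp (eq_zero_of_regular_parameter_mul_eq_zero hdim hm ?_)⟩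
  linear_combination -h

lemma mem_maximalIdeal_of_mul_add_mem_sq {x y u v : R} (hdim : ringKrullDim R = 2)
    (hm : maximalIdeal R = Ideal.span {x, y}) (h : u * x + v * y ∈ maximalIdeal R ^ 2) :
    u ∈ maximalIdeal R := by
  by_contra hu
  obtain ⟨u, rfl⟩ := notMem_maximalIdeal.mp hu
  have hle : maximalIdeal R ≤ Ideal.span {y} ⊔ maximalIdeal R • maximalIdeal R := by
    nth_rw 1 [hm]
    rw [Ideal.span_le]
    rintro z (rfl | rfl)
    · rw [smul_eq_mul, ← sq]
      have : z = -(↑u⁻¹ * v) * y + ↑u⁻¹ * (↑u * z + v * y) := by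
        linear_combination -z * u.inv_mul
      rw [this]
      exact Submodule.add_mem_sup (Ideal.mul_mem_left _ _ (Ideal.mem_span_singleton_self y))
        (Ideal.mul_mem_left _ _ h)
    · exact Ideal.mem_sup_left (Ideal.mem_span_singleton_self z)
  have hle' := Submodule.le_of_le_smul_of_le_jacobson_bot (IsNoetherian.noetherian _)
    (maximalIdeal_le_jacobson ⊥) hle
  refine pow_notMem_span_singleton (x := y) (y := x) hdim (by rw [hm, Set.pair_comm]) 1 ?_
  rw [pow_one]
  exact hle' (hm ▸ Ideal.subset_span (by simp))

/-- Regular parameters are linearly independent in `𝔪/𝔪²`. -/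
lemma mul_add_mem_sq_maximalIdeal_iff {x y u v : R} (hdim : ringKrullDim R = 2)
    (hm : maximalIdeal R = Ideal.span {x, y}) :
    u * x + v * y ∈ maximalIdeal R ^ 2 ↔ u ∈ maximalIdeal R ∧ v ∈ maximalIdeal R := by
  refine ⟨fun h ↦ ⟨mem_maximalIdeal_of_mul_add_mem_sq hdim hm h, ?_⟩, fun ⟨hu, hv⟩ ↦ ?_⟩
  · exact mem_maximalIdeal_of_mul_add_mem_sq (x := y) (y := x) (v := u) hdim
      (by rw [hm, Set.pair_comm]) (by rwa [add_comm])
  · rw [sq]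
    exact add_mem (Ideal.mul_mem_mul hu (hm ▸ Ideal.subset_span (by simp)))
      (Ideal.mul_mem_mul hv (hm ▸ Ideal.subset_span (by simp)))

end RegularParameters

section DoubleRing

variable {R : Type*} [CommRing R]

lemma tn_two_mul_self : tn R 2 * tn R 2 = 0 := by
  rw [tn, ← map_mul, ← sq]
  exact Ideal.Quotient.eq_zero_iff_mem.mpr (Ideal.mem_span_singleton_self _)

lemma ct2_algebraMap (r : R) : ct2 R (algebraMap R (Rn R 2) r) = r := by
  change eval 0 (C r) = r
  simp

lemma ct2_tn : ct2 R (tn R 2) = 0 := by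
  change eval 0 X = 0
  simp

lemma algebraMap_add_mul_tn_eq_zero_iff {r s : R} :
    algebraMap R (Rn R 2) r + algebraMap R (Rn R 2) s * tn R 2 = 0 ↔ r = 0 ∧ s = 0 := by
  refine ⟨fun h ↦ ?_, by rintro ⟨rfl, rfl⟩; simp⟩
  have h' : (C r + C s * X : R[X]) ∈ Ideal.span {(X : R[X]) ^ 2} :=
    Ideal.Quotient.eq_zero_iff_mem.mp h
  rw [Ideal.mem_span_singleton, X_pow_dvd_iff] at h'
  have h0 := h' 0 (by norm_num)
  have h1 := h' 1 (by norm_num)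
  simp at h0
  simp [coeff_C] at h1
  exact ⟨h0, h1⟩

lemma algebraMap_add_mul_tn_inj {r s r' s' : R}
    (h : algebraMap R (Rn R 2) r + algebraMap R (Rn R 2) s * tn R 2 =
      algebraMap R (Rn R 2) r' + algebraMap R (Rn R 2) s' * tn R 2) : r = r' ∧ s = s' := by
  rw [← sub_eq_zero, ← sub_eq_zero (a := s), ← algebraMap_add_mul_tn_eq_zero_iff]
  simp only [map_sub]
  linear_combination h

lemma exists_eq_algebraMap_ct2_add_mul_tn (a : Rn R 2) :
    ∃ s : R, a = algebraMap R (Rn R 2) (ct2 R a) + algebraMap R (Rn R 2) s * tn R 2 := by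
  obtain ⟨f, rfl⟩ := Ideal.Quotient.mk_surjective a
  have hf : f = C (eval 0 f) + C (f.divX.coeff 0) * X + f.divX.divX * X ^ 2 := by
    conv_lhs => rw [← f.divX_mul_X_add, ← f.divX.divX_mul_X_add]
    rw [← coeff_zero_eq_eval_zero]
    ring
  refine ⟨f.divX.coeff 0, ?_⟩
  change Ideal.Quotient.mk _ f = Ideal.Quotient.mk _ (C (eval 0 f) + C (f.divX.coeff 0) * X)
  rw [Ideal.Quotient.eq, Ideal.mem_span_singleton]
  exact ⟨f.divX.divX, by linear_combination hf⟩

lemma exists_eq_algebraMap_mul_tn {a : Rn R 2} (ha : a ∈ It R) :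
    ∃ s : R, a = algebraMap R (Rn R 2) s * tn R 2 := by
  obtain ⟨b, rfl⟩ := Ideal.mem_span_singleton.mp ha
  obtain ⟨s, hs⟩ := exists_eq_algebraMap_ct2_add_mul_tn b
  refine ⟨ct2 R b, ?_⟩
  nth_rw 1 [hs]
  linear_combination algebraMap R (Rn R 2) s * tn_two_mul_self (R := R)

lemma algebraMap_mul_tn_mem_map_mul_It_iff {J : Ideal R} {s : R} :
    algebraMap R (Rn R 2) s * tn R 2 ∈ J.map (algebraMap R (Rn R 2)) * It R ↔ s ∈ J := by
  refine ⟨fun h ↦ ?_, fun h ↦ Ideal.mul_mem_mul (Ideal.mem_map_of_mem _ h)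
    (Ideal.mem_span_singleton_self _)⟩
  obtain ⟨j, hj, hjs⟩ := Ideal.mem_mul_span_singleton.mp h
  have hj' : ct2 R j ∈ J := by
    have hid : (ct2 R).comp (algebraMap R (Rn R 2)) = RingHom.id R := RingHom.ext ct2_algebraMap
    have := Ideal.mem_map_of_mem (ct2 R) hj
    rwa [Ideal.map_map, hid, Ideal.map_id] at this
  obtain ⟨c, hc⟩ := exists_eq_algebraMap_ct2_add_mul_tn j
  have := algebraMap_add_mul_tn_inj (r := 0) (s := ct2 R j) (r' := 0) (s' := s) (by
    simp only [map_zero]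
    rw [← hjs]
    nth_rw 2 [hc]
    linear_combination -algebraMap R (Rn R 2) c * tn_two_mul_self (R := R))
  exact this.2 ▸ hj'

/-- Lifts to `R[t]/(t²)` of regular parameters of `R` have only the Koszul syzygy. -/
lemma exists_eq_mul_of_mul_eq_mul_of_ct2 [IsLocalRing R] [IsNoetherianRing R]
    (hdim : ringKrullDim R = 2) {x y p q : Rn R 2}
    (hm : IsLocalRing.maximalIdeal R = Ideal.span {ct2 R x, ct2 R y}) (h : y * p = x * q) :
    ∃ w, p = x * w ∧ q = y * w := by
  obtain ⟨x₁, hx⟩ := exists_eq_algebraMap_ct2_add_mul_tn x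
  obtain ⟨y₁, hy⟩ := exists_eq_algebraMap_ct2_add_mul_tn y
  obtain ⟨p₁, hp⟩ := exists_eq_algebraMap_ct2_add_mul_tn p
  obtain ⟨q₁, hq⟩ := exists_eq_algebraMap_ct2_add_mul_tn q
  generalize ct2 R x = x₀ at *
  generalize ct2 R y = y₀ at *
  generalize ct2 R p = p₀ at *
  generalize ct2 R q = q₀ at *
  have ht := tn_two_mul_self (R := R)
  obtain ⟨h₀, h₁⟩ := algebraMap_add_mul_tn_inj (r := y₀ * p₀) (s := y₀ * p₁ + y₁ * p₀)
    (r' := x₀ * q₀) (s' := x₀ * q₁ + x₁ * q₀) (by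
      rw [hx, hy, hp, hq] at h
      simp only [map_add, map_mul]
      linear_combination h + (algebraMap R (Rn R 2) x₁ * algebraMap R (Rn R 2) q₁ -
        algebraMap R (Rn R 2) y₁ * algebraMap R (Rn R 2) p₁) * ht)
  obtain ⟨w₀, rfl, rfl⟩ := exists_eq_mul_of_mul_eq_mul hdim hm h₀
  obtain ⟨w₁, hw, hw'⟩ := exists_eq_mul_of_mul_eq_mul (p := p₁ - x₁ * w₀) (q := q₁ - y₁ * w₀)
    hdim hm (by linear_combination h₁)
  rw [sub_eq_iff_eq_add] at hw hw'
  refine ⟨algebraMap R (Rn R 2) w₀ + algebraMap R (Rn R 2) w₁ * tn R 2, ?_, ?_⟩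
  · rw [hp, hx, hw]
    simp only [map_add, map_mul]
    linear_combination -algebraMap R (Rn R 2) x₁ * algebraMap R (Rn R 2) w₁ * ht
  · rw [hq, hy, hw']
    simp only [map_add, map_mul]
    linear_combination -algebraMap R (Rn R 2) y₁ * algebraMap R (Rn R 2) w₁ * ht

/-- An ideal isomorphic as a module to one generated by lifts of regular parameters is contained
in it. -/
lemma le_span_pair_of_linearEquiv [IsLocalRing R] [IsNoetherianRing R]
    (hdim : ringKrullDim R = 2) {x y : Rn R 2}
    (hm : IsLocalRing.maximalIdeal R = Ideal.span {ct2 R x, ct2 R y}) {J : Ideal (Rn R 2)}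
    (e : Ideal.span {x, y} ≃ₗ[Rn R 2] J) : J ≤ Ideal.span {x, y} := by
  let ex : Ideal.span {x, y} := ⟨x, Ideal.subset_span (by simp)⟩
  let ey : Ideal.span {x, y} := ⟨y, Ideal.subset_span (by simp)⟩
  have hsyz : y * (e ex : Rn R 2) = x * (e ey : Rn R 2) := by
    have : y • ex = x • ey := Subtype.ext (mul_comm y x)
    simpa using congrArg (fun z ↦ (e z : Rn R 2)) this
  obtain ⟨w, hx, hy⟩ := exists_eq_mul_of_mul_eq_mul_of_ct2 hdim hm hsyz
  intro z hz
  obtain ⟨⟨j, hj⟩, hjz⟩ := e.surjective ⟨z, hz⟩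
  obtain ⟨c, d, rfl⟩ := Ideal.mem_span_pair.mp hj
  have hsum : (⟨c * x + d * y, hj⟩ : Ideal.span {x, y}) = c • ex + d • ey := rfl
  have hzw : z = (c * x + d * y) * w := by
    rw [hsum, map_add, map_smul, map_smul] at hjz
    have := congrArg Subtype.val hjz
    simp only [Submodule.coe_add, Submodule.coe_smul, smul_eq_mul, hx, hy] at this
    linear_combination -this
  rw [hzw]
  exact Ideal.mul_mem_right _ _ hj

/-- Let `x, y` lift regular parameters and let `z` be an `R`-linear combination of them. An element
of `(x, y)` with the same constant term as `z` is congruent to `z` modulo `𝔪I`. -/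
lemma sub_mem_mIt_of_mem_span_pair [IsLocalRing R] [IsNoetherianRing R]
    (hdim : ringKrullDim R = 2) {x y : Rn R 2}
    (hm : IsLocalRing.maximalIdeal R = Ideal.span {ct2 R x, ct2 R y}) {c₀ d₀ : R}
    {z z' : Rn R 2} (hz : z = algebraMap R (Rn R 2) c₀ * x + algebraMap R (Rn R 2) d₀ * y)
    (hct : ct2 R z' = ct2 R z) (hz' : z' ∈ Ideal.span {x, y}) : z' - z ∈ mIt R := by
  obtain ⟨c, d, rfl⟩ := Ideal.mem_span_pair.mp hz'
  subst hz
  obtain ⟨x₁, hx⟩ := exists_eq_algebraMap_ct2_add_mul_tn x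
  obtain ⟨y₁, hy⟩ := exists_eq_algebraMap_ct2_add_mul_tn y
  obtain ⟨c₁, hc⟩ := exists_eq_algebraMap_ct2_add_mul_tn c
  obtain ⟨d₁, hd⟩ := exists_eq_algebraMap_ct2_add_mul_tn d
  simp only [map_add, map_mul, ct2_algebraMap] at hct
  generalize ct2 R x = x₀ at *
  generalize ct2 R y = y₀ at *
  generalize ct2 R c = c' at *
  generalize ct2 R d = d' at *
  have hrel : (c' - c₀) * x₀ + (d' - d₀) * y₀ = 0 := by linear_combination hct
  obtain ⟨hcm, hdm⟩ := (mul_add_mem_sq_maximalIdeal_iff hdim hm).mp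
    (hrel ▸ zero_mem (IsLocalRing.maximalIdeal R ^ 2))
  have hx₀ : x₀ ∈ IsLocalRing.maximalIdeal R := hm ▸ Ideal.subset_span (by simp)
  have hy₀ : y₀ ∈ IsLocalRing.maximalIdeal R := hm ▸ Ideal.subset_span (by simp)
  have heq : c * x + d * y - (algebraMap R (Rn R 2) c₀ * x + algebraMap R (Rn R 2) d₀ * y) =
      algebraMap R (Rn R 2) (x₁ * (c' - c₀) + c₁ * x₀ + (y₁ * (d' - d₀) + d₁ * y₀)) * tn R 2 := by
    have hrel' := congrArg (algebraMap R (Rn R 2)) hrel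
    rw [hx, hy, hc, hd]
    simp only [map_add, map_mul, map_sub, map_zero] at hrel' ⊢
    linear_combination hrel' + (algebraMap R (Rn R 2) c₁ * algebraMap R (Rn R 2) x₁ +
      algebraMap R (Rn R 2) d₁ * algebraMap R (Rn R 2) y₁) * tn_two_mul_self (R := R)
  rw [heq]
  refine algebraMap_mul_tn_mem_map_mul_It_iff.mpr (add_mem (add_mem ?_ ?_) (add_mem ?_ ?_))
  exacts [Ideal.mul_mem_left _ _ hcm, Ideal.mul_mem_left _ _ hx₀, Ideal.mul_mem_left _ _ hdm,
    Ideal.mul_mem_left _ _ hy₀]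

lemma mIt_le_span_pair [IsLocalRing R] {x y : Rn R 2}
    (hm : IsLocalRing.maximalIdeal R = Ideal.span {ct2 R x, ct2 R y}) :
    mIt R ≤ Ideal.span {x, y} := by
  intro z hz
  rw [mIt] at hz
  obtain ⟨s, rfl⟩ := exists_eq_algebraMap_mul_tn (Ideal.mul_le_right hz)
  rw [algebraMap_mul_tn_mem_map_mul_It_iff, hm] at hz
  obtain ⟨c, d, rfl⟩ := Ideal.mem_span_pair.mp hz
  obtain ⟨x₁, hx⟩ := exists_eq_algebraMap_ct2_add_mul_tn x
  obtain ⟨y₁, hy⟩ := exists_eq_algebraMap_ct2_add_mul_tn y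
  clear hz hm
  generalize ct2 R x = x₀ at *
  generalize ct2 R y = y₀ at *
  subst hx hy
  refine Ideal.mem_span_pair.mpr
    ⟨algebraMap R (Rn R 2) c * tn R 2, algebraMap R (Rn R 2) d * tn R 2, ?_⟩
  simp only [map_add, map_mul]
  linear_combination (algebraMap R (Rn R 2) c * algebraMap R (Rn R 2) x₁ +
    algebraMap R (Rn R 2) d * algebraMap R (Rn R 2) y₁) * tn_two_mul_self (R := R)

lemma span_pair_le_of_sub_mem_mIt [IsLocalRing R] {x y x' y' : Rn R 2}
    (hm : IsLocalRing.maximalIdeal R = Ideal.span {ct2 R x, ct2 R y})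
    (hx : x' - x ∈ mIt R) (hy : y' - y ∈ mIt R) :
    Ideal.span {x', y'} ≤ Ideal.span {x, y} := by
  have key : ∀ {z z' : Rn R 2}, z ∈ Ideal.span {x, y} → z' - z ∈ mIt R →
      z' ∈ Ideal.span {x, y} := fun {z z'} hz h ↦ by
    simpa using add_mem (mIt_le_span_pair hm h) hz
  rw [Ideal.span_le]
  rintro z (rfl | rfl)
  exacts [key (Ideal.subset_span (by simp)) hx, key (Ideal.subset_span (by simp)) hy]

lemma ct2_eq_zero_of_mem_It {a : Rn R 2} (ha : a ∈ It R) : ct2 R a = 0 := by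
  obtain ⟨s, rfl⟩ := exists_eq_algebraMap_mul_tn ha
  rw [map_mul, ct2_tn, mul_zero]

end DoubleRing

/-- Let `R` be a 2-dimensional regular local ring containing `ℂ` with residue field `ℂ`,
with maximal ideal `𝔪`, `A = R[t]/(t²)` and `I = (t) ⊆ A`. Let `x, y ∈ A` whose images
`x₀, y₀` in `R` generate `𝔪`, and `Ā, B̄, Ā', B̄' ∈ I`. Let `τ` (resp. `τ'`) be the image
of `-y₀Ā + x₀B̄` (resp. `-y₀Ā' + x₀B̄'`) in `𝔪I/𝔪²I`. The following are equivalent: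
(i) `(x+Ā, y+B̄) = (x+Ā', y+B̄')` as ideals of `A`;
(ii) `τ = τ'` (i.e. the difference of the two representatives lies in `𝔪²I`);
(iii) `Ā' - Ā ∈ 𝔪I` and `B̄' - B̄ ∈ 𝔪I`;
(iv) the `A`-modules `(x+Ā, y+B̄)` and `(x+Ā', y+B̄')` are isomorphic. -/
theorem ideal_generators_tfae
    {R : Type*} [CommRing R] [IsLocalRing R] [IsNoetherianRing R] [Algebra ℂ R]
    (hdim : ringKrullDim R = 2)
    (hreg : ∃ a b : R, IsLocalRing.maximalIdeal R = Ideal.span {a, b})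
    (hres : ∀ r : R, ∃ c : ℂ, r - algebraMap ℂ R c ∈ IsLocalRing.maximalIdeal R)
    (x y : Rn R 2)
    (hxy : IsLocalRing.maximalIdeal R = Ideal.span {ct2 R x, ct2 R y})
    (A B A' B' : Rn R 2)
    (hA : A ∈ It R) (hB : B ∈ It R) (hA' : A' ∈ It R) (hB' : B' ∈ It R) :
    List.TFAE
      [ Ideal.span {x + A, y + B} = Ideal.span {x + A', y + B'},
        (-(algebraMap R (Rn R 2) (ct2 R y)) * A + algebraMap R (Rn R 2) (ct2 R x) * B) -
            (-(algebraMap R (Rn R 2) (ct2 R y)) * A' + algebraMap R (Rn R 2) (ct2 R x) * B')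
          ∈ m2It R,
        A' - A ∈ mIt R ∧ B' - B ∈ mIt R,
        Nonempty ((Ideal.span {x + A, y + B}) ≃ₗ[Rn R 2] (Ideal.span {x + A', y + B'})) ] := by
  have hm : IsLocalRing.maximalIdeal R = Ideal.span {ct2 R (x + A), ct2 R (y + B)} := by
    simpa [ct2_eq_zero_of_mem_It hA, ct2_eq_zero_of_mem_It hB] using hxy
  have hm' : IsLocalRing.maximalIdeal R = Ideal.span {ct2 R (x + A'), ct2 R (y + B')} := by
    simpa [ct2_eq_zero_of_mem_It hA', ct2_eq_zero_of_mem_It hB'] using hxy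
  tfae_have 1 → 4 := fun h ↦ ⟨LinearEquiv.ofEq _ _ h⟩
  tfae_have 4 → 3 := by
    rintro ⟨e⟩
    have hle := le_span_pair_of_linearEquiv hdim hm e
    rw [← add_sub_add_left_eq_sub A' A x, ← add_sub_add_left_eq_sub B' B y]
    refine ⟨sub_mem_mIt_of_mem_span_pair hdim hm (c₀ := 1) (d₀ := 0) (by simp) ?_
        (hle (Ideal.subset_span (by simp))),
      sub_mem_mIt_of_mem_span_pair hdim hm (c₀ := 0) (d₀ := 1) (by simp) ?_
        (hle (Ideal.subset_span (by simp)))⟩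
    · simp [ct2_eq_zero_of_mem_It hA, ct2_eq_zero_of_mem_It hA']
    · simp [ct2_eq_zero_of_mem_It hB, ct2_eq_zero_of_mem_It hB']
  tfae_have 3 → 1 := by
    rintro ⟨hAA, hBB⟩
    rw [← add_sub_add_left_eq_sub A' A x] at hAA
    rw [← add_sub_add_left_eq_sub B' B y] at hBB
    exact le_antisymm
      (span_pair_le_of_sub_mem_mIt hm' (neg_sub (x + A') _ ▸ neg_mem hAA)
        (neg_sub (y + B') _ ▸ neg_mem hBB))
      (span_pair_le_of_sub_mem_mIt hm hAA hBB)
  tfae_have 2 ↔ 3 := by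
    obtain ⟨a, rfl⟩ := exists_eq_algebraMap_mul_tn hA
    obtain ⟨b, rfl⟩ := exists_eq_algebraMap_mul_tn hB
    obtain ⟨a', rfl⟩ := exists_eq_algebraMap_mul_tn hA'
    obtain ⟨b', rfl⟩ := exists_eq_algebraMap_mul_tn hB'
    rw [← sub_mul, ← sub_mul, ← map_sub, ← map_sub, mIt, algebraMap_mul_tn_mem_map_mul_It_iff,
      algebraMap_mul_tn_mem_map_mul_It_iff, m2It, ← Ideal.map_pow, ← neg_mem_iff (x := b' - b),
      and_comm, ← mul_add_mem_sq_maximalIdeal_iff hdim hxy,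
      ← algebraMap_mul_tn_mem_map_mul_It_iff (R := R) (J := _ ^ 2)]
    refine iff_of_eq (congrArg (· ∈ _) ?_)
    simp only [map_add, map_mul, map_sub, map_neg]
    ring
  tfae_finish
end
end
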